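/- arXiv:1304.6420 — 2 statements merged into one kernel-verified Lean document; each statement's English description precedes it below -/
import Mathlib

section
/- Let G be a graph on vertex set {v^1,…,v^n}, let ℓ ≥ 4 be an integer, and let G' be the graph CliqueGadget(G,ℓ). If {v^{i_1},…,v^{i_ℓ}} is a clique of size ℓ in G, then taking S = {v^{i_1}_{1j} : j ≠ 1} ∪ … ∪ {v^{i_ℓ}_{ℓj} : j ≠ ℓ} (one full cycle from each block) and B the set of ℓ(ℓ−1)/2 green vertices g^{(i_q,i_r)}_{\{q,r\}} for q < r, the pair (B, S ∪ B) is an anchored 3-core of G' with |B| = ℓ(ℓ−1)/2 and |S ∪ B| = 3·ℓ(ℓ−1)/2. -/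
/-- `(B, H)` is an anchored `k`-core of `G`: `B ⊆ H` and every vertex of `H \ B`
has at least `k` neighbors within `H` (i.e. degree at least `k` in `G[H]`). -/
def IsAnchoredKCore {V : Type*} (G : SimpleGraph V) (k : ℕ) (B H : Set V) : Prop :=
  B ⊆ H ∧ ∀ v ∈ H \ B, k ≤ {u | u ∈ H ∧ G.Adj v u}.ncard

/-- Vertices of `CliqueGadget G ℓ` for a graph `G` on `Fin n`:
`Sum.inl ⟨(r, i, j), _⟩` is the vertex `v^r_{ij}` (for `i ≠ j`), and
`Sum.inr ⟨((r, s), i, j), _⟩` is the green vertex `g^{(r,s)}_{{i,j}}`, indexed by the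
ordered pair `(r, s)` with `v^r v^s ∈ E(G)` and the unordered pair `{i,j}` encoded
by the representative with `i < j`. -/
abbrev GadgetVert (n ℓ : ℕ) (G : SimpleGraph (Fin n)) : Type :=
  {p : Fin n × Fin ℓ × Fin ℓ // p.2.1 ≠ p.2.2} ⊕
  {q : (Fin n × Fin n) × Fin ℓ × Fin ℓ // G.Adj q.1.1 q.1.2 ∧ q.2.1 < q.2.2}

/-- The successor of `j` in the cyclic order `1, 2, …, ℓ, 1, …` on `Fin ℓ`, skipping `i`. -/
def cycNext {ℓ : ℕ} (i j : Fin ℓ) : Fin ℓ :=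
  if (⟨(j.val + 1) % ℓ, Nat.mod_lt _ j.pos⟩ : Fin ℓ) = i then
    ⟨(j.val + 2) % ℓ, Nat.mod_lt _ j.pos⟩
  else
    ⟨(j.val + 1) % ℓ, Nat.mod_lt _ j.pos⟩

/-- `j` and `j'` are consecutive on the cycle `v^r_{i1} – v^r_{i2} – … – v^r_{iℓ} – v^r_{i1}`
through all indices distinct from `i`. -/
def CycleAdj {ℓ : ℕ} (i j j' : Fin ℓ) : Prop :=
  j ≠ i ∧ j' ≠ i ∧ j ≠ j' ∧ (cycNext i j = j' ∨ cycNext i j' = j)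

/-- The graph `CliqueGadget(G, ℓ)`: for each `i` and `r` the vertices `v^r_{ij}` (`j ≠ i`)
form a cycle in the natural cyclic order, and each green vertex `g^{(r,s)}_{{i,j}}`
(with `i < j`) is adjacent exactly to `v^r_{ij}` and `v^s_{ji}`. -/
def CliqueGadget (n ℓ : ℕ) (G : SimpleGraph (Fin n)) : SimpleGraph (GadgetVert n ℓ G) :=
  SimpleGraph.fromRel (fun x y =>
    match x, y with
    | Sum.inl a, Sum.inl b =>
        a.1.1 = b.1.1 ∧ a.1.2.1 = b.1.2.1 ∧ CycleAdj a.1.2.1 a.1.2.2 b.1.2.2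
    | Sum.inl a, Sum.inr g =>
        a.1 = (g.1.1.1, g.1.2.1, g.1.2.2) ∨ a.1 = (g.1.1.2, g.1.2.2, g.1.2.1)
    | _, _ => False)

theorem cycNext_val {ℓ : ℕ} (hℓ : 2 ≤ ℓ) (i j : Fin ℓ) :
    (cycNext i j).val =
      if (if j.val + 1 < ℓ then j.val + 1 else 0) = i.val then
        (if j.val + 2 < ℓ then j.val + 2 else j.val + 2 - ℓ)
      else (if j.val + 1 < ℓ then j.val + 1 else 0) := by
  have hj := j.isLt
  have h1 : (j.val + 1) % ℓ = if j.val + 1 < ℓ then j.val + 1 else 0 := by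
    split_ifs with h
    · exact Nat.mod_eq_of_lt h
    · rw [show j.val + 1 = ℓ by omega, Nat.mod_self]
  have h2 : (j.val + 2) % ℓ = if j.val + 2 < ℓ then j.val + 2 else j.val + 2 - ℓ := by
    split_ifs with h
    · exact Nat.mod_eq_of_lt h
    · rw [Nat.mod_eq_sub_mod (by omega), Nat.mod_eq_of_lt (by omega)]
  simp only [cycNext, Fin.ext_iff, h1, h2]
  split_ifs <;> rfl

theorem exists_cycNext_eq {ℓ : ℕ} (hℓ : 3 ≤ ℓ) {i j : Fin ℓ} (hij : j ≠ i) :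
    ∃ b : Fin ℓ, b ≠ i ∧ cycNext i b = j := by
  have hj := j.isLt
  have hi := i.isLt
  rw [Ne, Fin.ext_iff] at hij
  by_cases h : (if j.val = 0 then ℓ - 1 else j.val - 1) = i.val
  · refine ⟨⟨if i.val = 0 then ℓ - 1 else i.val - 1, by split_ifs <;> omega⟩, ?_, ?_⟩
    · simp only [Ne, Fin.ext_iff]
      split_ifs <;> omega
    · rw [Fin.ext_iff, cycNext_val (by omega)]
      dsimp only
      grind
  · refine ⟨⟨if j.val = 0 then ℓ - 1 else j.val - 1, by split_ifs <;> omega⟩, ?_, ?_⟩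
    · simpa only [Ne, Fin.ext_iff] using h
    · rw [Fin.ext_iff, cycNext_val (by omega)]
      dsimp only
      grind

/-- On a cycle of length `ℓ - 1 ≥ 3` every vertex has two distinct neighbors. -/
theorem exists_cycleAdj_pair {ℓ : ℕ} (hℓ : 4 ≤ ℓ) {i j : Fin ℓ} (hij : j ≠ i) :
    ∃ a b : Fin ℓ, a ≠ b ∧ CycleAdj i j a ∧ CycleAdj i j b := by
  obtain ⟨b, hbi, hb⟩ := exists_cycNext_eq (by omega) hij
  have hv := cycNext_val (by omega) i j
  have hw := cycNext_val (by omega) i b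
  rw [hb] at hw
  have := j.isLt
  have := i.isLt
  have := b.isLt
  simp only [Ne, Fin.ext_iff] at hij hbi
  refine ⟨cycNext i j, b, ?_, ⟨?_, ?_, ?_, Or.inl rfl⟩, ⟨?_, ?_, ?_, Or.inr hb⟩⟩ <;>
    simp only [Ne, Fin.ext_iff] <;> grind

theorem card_ne_pairs (ℓ : ℕ) :
    Nat.card {p : Fin ℓ × Fin ℓ // p.1 ≠ p.2} = ℓ * (ℓ - 1) := by
  have h : (Finset.univ : Finset (Fin ℓ × Fin ℓ)).filter (fun p => p.1 ≠ p.2) =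
      (Finset.univ : Finset (Fin ℓ)).offDiag := by
    ext p
    simp
  rw [Nat.card_eq_fintype_card, Fintype.card_subtype, h, Finset.offDiag_card, Finset.card_univ,
    Fintype.card_fin, Nat.mul_sub_one]

theorem card_lt_pairs (ℓ : ℕ) :
    Nat.card {p : Fin ℓ × Fin ℓ // p.1 < p.2} = ℓ * (ℓ - 1) / 2 := by
  have e : {p : Fin ℓ × Fin ℓ // p.1 < p.2} ≃ Σ r : Fin ℓ, {q : Fin ℓ // q < r} :=
    { toFun := fun p => ⟨p.1.2, p.1.1, p.2⟩
      invFun := fun s => ⟨(s.2.1, s.1), s.2.2⟩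
      left_inv := fun _ => rfl
      right_inv := fun _ => rfl }
  rw [Nat.card_congr e, Nat.card_sigma, ← Finset.sum_range_id, ← Fin.sum_univ_eq_sum_range]
  refine Finset.sum_congr rfl fun r _ => ?_
  rw [Nat.card_eq_fintype_card, Fintype.card_subtype, Finset.filter_gt_eq_Iio, Fin.card_Iio]

section CliqueGadget

variable {n ℓ : ℕ} {G : SimpleGraph (Fin n)}

theorem cliqueGadget_adj_inl_inl {r : Fin n} {i j j' : Fin ℓ} (h : i ≠ j) (h' : i ≠ j')
    (hc : CycleAdj i j j') :
    (CliqueGadget n ℓ G).Adj (Sum.inl ⟨(r, i, j), h⟩) (Sum.inl ⟨(r, i, j'), h'⟩) := by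
  refine (SimpleGraph.fromRel_adj _ _ _).2 ⟨?_, Or.inl ⟨rfl, rfl, hc⟩⟩
  intro heq
  simp only [Sum.inl.injEq, Subtype.mk.injEq, Prod.mk.injEq] at heq
  exact hc.2.2.1 heq.2.2

theorem cliqueGadget_adj_inl_inr_fst {r s : Fin n} {i j : Fin ℓ} (h : i ≠ j)
    (hg : G.Adj r s ∧ i < j) :
    (CliqueGadget n ℓ G).Adj (Sum.inl ⟨(r, i, j), h⟩) (Sum.inr ⟨((r, s), i, j), hg⟩) :=
  (SimpleGraph.fromRel_adj _ _ _).2 ⟨Sum.inl_ne_inr, Or.inl (Or.inl rfl)⟩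

theorem cliqueGadget_adj_inl_inr_snd {r s : Fin n} {i j : Fin ℓ} (h : j ≠ i)
    (hg : G.Adj r s ∧ i < j) :
    (CliqueGadget n ℓ G).Adj (Sum.inl ⟨(s, j, i), h⟩) (Sum.inr ⟨((r, s), i, j), hg⟩) :=
  (SimpleGraph.fromRel_adj _ _ _).2 ⟨Sum.inl_ne_inr, Or.inl (Or.inr rfl)⟩

theorem ncard_clique_cycles (c : Fin ℓ → Fin n) :
    {x : GadgetVert n ℓ G | ∃ (q j : Fin ℓ) (h : q ≠ j),
      x = Sum.inl ⟨(c q, q, j), h⟩}.ncard = ℓ * (ℓ - 1) := by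
  let f : {p : Fin ℓ × Fin ℓ // p.1 ≠ p.2} → GadgetVert n ℓ G :=
    fun p => Sum.inl ⟨(c p.1.1, p.1.1, p.1.2), p.2⟩
  have hf : Function.Injective f := by
    rintro ⟨⟨a, b⟩, h⟩ ⟨⟨a', b'⟩, h'⟩ heq
    simp only [f, Sum.inl.injEq, Subtype.mk.injEq, Prod.mk.injEq] at heq ⊢
    exact heq.2
  rw [← card_ne_pairs ℓ, ← Nat.card_range_of_injective hf, Nat.card_coe_set_eq]
  refine congrArg Set.ncard (Set.ext fun x => ⟨?_, ?_⟩)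
  · rintro ⟨a, b, h, rfl⟩
    exact ⟨⟨(a, b), h⟩, rfl⟩
  · rintro ⟨p, rfl⟩
    exact ⟨p.1.1, p.1.2, p.2, rfl⟩

theorem ncard_clique_greens (c : Fin ℓ → Fin n)
    (hadj : ∀ q r : Fin ℓ, q ≠ r → G.Adj (c q) (c r)) :
    {x : GadgetVert n ℓ G | ∃ (q r : Fin ℓ) (h : q < r),
      x = Sum.inr ⟨((c q, c r), q, r), hadj q r h.ne, h⟩}.ncard = ℓ * (ℓ - 1) / 2 := by
  let f : {p : Fin ℓ × Fin ℓ // p.1 < p.2} → GadgetVert n ℓ G :=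
    fun p => Sum.inr ⟨((c p.1.1, c p.1.2), p.1.1, p.1.2), hadj _ _ p.2.ne, p.2⟩
  have hf : Function.Injective f := by
    rintro ⟨⟨a, b⟩, h⟩ ⟨⟨a', b'⟩, h'⟩ heq
    simp only [f, Sum.inr.injEq, Subtype.mk.injEq, Prod.mk.injEq] at heq ⊢
    exact heq.2
  rw [← card_lt_pairs ℓ, ← Nat.card_range_of_injective hf, Nat.card_coe_set_eq]
  refine congrArg Set.ncard (Set.ext fun x => ⟨?_, ?_⟩)
  · rintro ⟨a, b, h, rfl⟩
    exact ⟨⟨(a, b), h⟩, rfl⟩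
  · rintro ⟨p, rfl⟩
    exact ⟨p.1.1, p.1.2, p.2, rfl⟩

end CliqueGadget

theorem stmt_7 (n ℓ : ℕ) (hℓ : 4 ≤ ℓ) (G : SimpleGraph (Fin n))
    (c : Fin ℓ → Fin n) (hadj : ∀ q r : Fin ℓ, q ≠ r → G.Adj (c q) (c r)) :
    IsAnchoredKCore (CliqueGadget n ℓ G) 3
      {x : GadgetVert n ℓ G | ∃ (q r : Fin ℓ) (h : q < r),
        x = Sum.inr ⟨((c q, c r), q, r), hadj q r h.ne, h⟩}
      ({x : GadgetVert n ℓ G | ∃ (q j : Fin ℓ) (h : q ≠ j),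
          x = Sum.inl ⟨(c q, q, j), h⟩} ∪
       {x : GadgetVert n ℓ G | ∃ (q r : Fin ℓ) (h : q < r),
          x = Sum.inr ⟨((c q, c r), q, r), hadj q r h.ne, h⟩}) ∧
    {x : GadgetVert n ℓ G | ∃ (q r : Fin ℓ) (h : q < r),
        x = Sum.inr ⟨((c q, c r), q, r), hadj q r h.ne, h⟩}.ncard = ℓ * (ℓ - 1) / 2 ∧
    ({x : GadgetVert n ℓ G | ∃ (q j : Fin ℓ) (h : q ≠ j),
        x = Sum.inl ⟨(c q, q, j), h⟩} ∪
     {x : GadgetVert n ℓ G | ∃ (q r : Fin ℓ) (h : q < r),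
        x = Sum.inr ⟨((c q, c r), q, r), hadj q r h.ne, h⟩}).ncard
      = 3 * (ℓ * (ℓ - 1) / 2) := by
  have hB := ncard_clique_greens c hadj
  have hS := ncard_clique_cycles (G := G) c
  refine ⟨⟨Set.subset_union_right, ?_⟩, hB, ?_⟩
  · rintro v ⟨⟨q, j, h, rfl⟩ | hv, hvB⟩
    swap
    · exact absurd hv hvB
    obtain ⟨a, b, hab, ha, hb⟩ := exists_cycleAdj_pair hℓ h.symm
    obtain ⟨g, hgB, hg⟩ : ∃ g, (∃ (q r : Fin ℓ) (h : q < r),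
          Sum.inr g = (Sum.inr ⟨((c q, c r), q, r), hadj q r h.ne, h⟩ : GadgetVert n ℓ G)) ∧
        (CliqueGadget n ℓ G).Adj (Sum.inl ⟨(c q, q, j), h⟩) (Sum.inr g) := by
      rcases h.lt_or_gt with hlt | hgt
      · exact ⟨_, ⟨q, j, hlt, rfl⟩, cliqueGadget_adj_inl_inr_fst h _⟩
      · exact ⟨_, ⟨j, q, hgt, rfl⟩, cliqueGadget_adj_inl_inr_snd h _⟩
    have hcard : ({Sum.inl ⟨(c q, q, a), ha.2.1.symm⟩, Sum.inl ⟨(c q, q, b), hb.2.1.symm⟩,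
        Sum.inr g} : Set (GadgetVert n ℓ G)).ncard = 3 :=
      Set.ncard_eq_three.2 ⟨_, _, _, by simpa using hab, Sum.inl_ne_inr, Sum.inl_ne_inr, rfl⟩
    rw [← hcard]
    refine Set.ncard_le_ncard ?_ (Set.toFinite _)
    rintro x (rfl | rfl | rfl)
    · exact ⟨Or.inl ⟨q, a, _, rfl⟩, cliqueGadget_adj_inl_inl _ _ ha⟩
    · exact ⟨Or.inl ⟨q, b, _, rfl⟩, cliqueGadget_adj_inl_inl _ _ hb⟩
    · exact ⟨Or.inr hgB, hg⟩
  · rw [Set.ncard_union_eq _ (Set.toFinite _) (Set.toFinite _), hS, hB]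
    · have := Nat.div_mul_cancel (Nat.even_mul_pred_self ℓ).two_dvd
      omega
    · rw [Set.disjoint_left]
      rintro _ ⟨q, j, h, rfl⟩ ⟨q', r', h', heq⟩
      exact Sum.inl_ne_inr heq
end

section
/- Let G be a graph on vertex set {v^1,…,v^n}, let ℓ ≥ 4 be an integer, and let G' be the graph CliqueGadget(G,ℓ). If there exist sets B ⊆ H ⊆ V(G') with |B| ≤ ℓ(ℓ−1)/2 and |H| ≥ 3·ℓ(ℓ−1)/2 such that (B,H) is an anchored 3-core of G', then G has a clique of size ℓ; moreover in any such solution B consists of exactly ℓ(ℓ−1)/2 green vertices, |H \ B| = ℓ(ℓ−1), and there are indices i_1,…,i_ℓ ∈ {1,…,n} such that H \ B is the union of the ℓ cycles on {v^{i_q}_{qj} : j ≠ q}, q ∈ {1,…,ℓ}, and {v^{i_1},…,v^{i_ℓ}} is a clique in G. -/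
/-- The vertices `v^r_{ij}` of the clique gadget. -/
abbrev CycleVert (n ℓ : ℕ) : Type := {p : Fin n × Fin ℓ × Fin ℓ // p.2.1 ≠ p.2.2}

/-- The green vertices of the clique gadget. -/
abbrev GreenVert (n ℓ : ℕ) (G : SimpleGraph (Fin n)) : Type :=
  {q : (Fin n × Fin n) × Fin ℓ × Fin ℓ // G.Adj q.1.1 q.1.2 ∧ q.2.1 < q.2.2}

/-- The neighbor `v^r_{ij}` of the green vertex `g^{(r,s)}_{{i,j}}`. -/
def greenFst {n ℓ : ℕ} {G : SimpleGraph (Fin n)} (g : GreenVert n ℓ G) : CycleVert n ℓ :=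
  ⟨(g.1.1.1, g.1.2.1, g.1.2.2), g.2.2.ne⟩

/-- The neighbor `v^s_{ji}` of the green vertex `g^{(r,s)}_{{i,j}}`. -/
def greenSnd {n ℓ : ℕ} {G : SimpleGraph (Fin n)} (g : GreenVert n ℓ G) : CycleVert n ℓ :=
  ⟨(g.1.1.2, g.1.2.2, g.1.2.1), g.2.2.ne'⟩

lemma Fin.val_add_one_mod {ℓ : ℕ} (j : Fin ℓ) :
    (j.val + 1) % ℓ = if j.val + 1 = ℓ then 0 else j.val + 1 := by
  have := j.isLt
  split_ifs with h
  · simp [h]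
  · exact Nat.mod_eq_of_lt (by omega)

lemma Fin.val_add_two_mod {ℓ : ℕ} (hℓ : 2 ≤ ℓ) (j : Fin ℓ) :
    (j.val + 2) % ℓ = if ℓ ≤ j.val + 2 then j.val + 2 - ℓ else j.val + 2 := by
  have := j.isLt
  split_ifs with h
  · rw [Nat.mod_eq_sub_mod h]
    rcases Nat.lt_or_ge (j.val + 2 - ℓ) ℓ with h' | h'
    · exact Nat.mod_eq_of_lt h'
    · omega
  · exact Nat.mod_eq_of_lt (by omega)

lemma cycNext_ne {ℓ : ℕ} (hℓ : 2 ≤ ℓ) (i j : Fin ℓ) : cycNext i j ≠ i := by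
  have hj := j.isLt
  unfold cycNext
  split_ifs with h
  · intro h'
    have e : (j.val + 1) % ℓ = i.val := congrArg Fin.val h
    have e' : (j.val + 2) % ℓ = i.val := congrArg Fin.val h'
    rw [Fin.val_add_one_mod] at e
    rw [Fin.val_add_two_mod hℓ] at e'
    split_ifs at * <;> omega
  · exact h

lemma cycNext_injOn {ℓ : ℕ} (hℓ : 3 ≤ ℓ) {i j j' : Fin ℓ} (hj : j ≠ i) (hj' : j' ≠ i)
    (h : cycNext i j = cycNext i j') : j = j' := by
  have h1 := j.isLt
  have h2 := j'.isLt
  have h3 := i.isLt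
  unfold cycNext at h
  simp only [Fin.ext_iff, apply_ite Fin.val, Fin.val_add_one_mod,
    Fin.val_add_two_mod (by omega : 2 ≤ ℓ), ne_eq] at *
  split_ifs at * <;> omega

/-- A property stable under `cycNext i` holds on the whole cycle once it holds at one vertex. -/
lemma cycNext_induction {ℓ : ℕ} (hℓ : 2 ≤ ℓ) {i : Fin ℓ} (P : Fin ℓ → Prop)
    (step : ∀ j, j ≠ i → P j → P (cycNext i j)) {j₀ : Fin ℓ} (h₀ : j₀ ≠ i) (hP : P j₀)
    (j : Fin ℓ) (hj : j ≠ i) : P j := by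
  let pos (m : ℕ) : Fin ℓ := ⟨(j₀.val + m) % ℓ, Nat.mod_lt _ j₀.pos⟩
  have next_pos (m : ℕ) :
      cycNext i (pos m) = if pos (m + 1) = i then pos (m + 2) else pos (m + 1) := by
    simp [cycNext, pos, Nat.add_assoc]
  have key : ∀ m : ℕ, (pos m ≠ i ∧ P (pos m)) ∨
      (pos m = i ∧ pos (m + 1) ≠ i ∧ P (pos (m + 1))) := by
    intro m
    induction m with
    | zero =>
      have : pos 0 = j₀ := Fin.ext (by simp [pos, Nat.mod_eq_of_lt j₀.isLt])
      exact Or.inl (this.symm ▸ ⟨h₀, hP⟩)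
    | succ m ih =>
      rcases ih with ⟨hne, hm⟩ | ⟨-, hm⟩
      · have hs := step _ hne hm
        have hn := cycNext_ne hℓ i (pos m)
        rw [next_pos] at hs hn
        split_ifs at hs hn with h
        · exact Or.inr ⟨h, hn, hs⟩
        · exact Or.inl ⟨h, hs⟩
      · exact Or.inl hm
  have hpos : pos (j.val + ℓ - j₀.val) = j := by
    have := j₀.isLt
    refine Fin.ext ?_
    simp only [pos]
    rw [show j₀.val + (j.val + ℓ - j₀.val) = j.val + ℓ by omega, Nat.add_mod_right,
      Nat.mod_eq_of_lt j.isLt]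
  rcases key (j.val + ℓ - j₀.val) with ⟨-, h⟩ | ⟨h, -⟩
  · exact hpos ▸ h
  · exact absurd (hpos ▸ h) hj

section Gadget

variable {n ℓ : ℕ} {G : SimpleGraph (Fin n)}

/-- The vertex `v^r_{ij'}` following `v^r_{ij}` on its cycle. -/
def CycleVert.next (hℓ : 2 ≤ ℓ) (a : CycleVert n ℓ) : CycleVert n ℓ :=
  ⟨(a.1.1, a.1.2.1, cycNext a.1.2.1 a.1.2.2), (cycNext_ne hℓ _ _).symm⟩

lemma CycleVert.next_injective (hℓ : 3 ≤ ℓ) :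
    Function.Injective (CycleVert.next (n := n) (ℓ := ℓ) (by omega)) := by
  rintro ⟨⟨r, i, j⟩, hij⟩ ⟨⟨r', i', j'⟩, hij'⟩ h
  simp only [CycleVert.next, Subtype.mk.injEq, Prod.mk.injEq] at h
  obtain ⟨rfl, rfl, h⟩ := h
  obtain rfl := cycNext_injOn hℓ hij.symm hij'.symm h
  rfl

lemma CliqueGadget.adj_inl_inl (hℓ : 2 ≤ ℓ) {a b : CycleVert n ℓ}
    (h : (CliqueGadget n ℓ G).Adj (Sum.inl a) (Sum.inl b)) :
    b = a.next hℓ ∨ b.next hℓ = a := by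
  obtain ⟨⟨r, i, j⟩, hij⟩ := a
  obtain ⟨⟨r', i', j'⟩, hij'⟩ := b
  simp only [CliqueGadget, SimpleGraph.fromRel_adj, CycleAdj] at h
  simp only [CycleVert.next, Subtype.mk.injEq, Prod.mk.injEq]
  rcases h with ⟨-, ⟨rfl, rfl, -, -, -, h⟩ | ⟨rfl, rfl, -, -, -, h⟩⟩ <;> grind

lemma CliqueGadget.adj_inl_inr {a : CycleVert n ℓ} {g : GreenVert n ℓ G}
    (h : (CliqueGadget n ℓ G).Adj (Sum.inl a) (Sum.inr g)) :
    a = greenFst g ∨ a = greenSnd g := by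
  simp only [CliqueGadget, SimpleGraph.fromRel_adj] at h
  simpa [greenFst, greenSnd, Subtype.ext_iff] using h.2

lemma CliqueGadget.not_adj_inr_inr (g g' : GreenVert n ℓ G) :
    ¬ (CliqueGadget n ℓ G).Adj (Sum.inr g) (Sum.inr g') := by
  simp [CliqueGadget, SimpleGraph.fromRel_adj]

variable {B H : Set (GadgetVert n ℓ G)}

/-- Green vertices have degree two, so in an anchored `3`-core they are all anchors. -/
lemma IsAnchoredKCore.inr_mem (hcore : IsAnchoredKCore (CliqueGadget n ℓ G) 3 B H)
    {g : GreenVert n ℓ G} (hg : Sum.inr g ∈ H) : Sum.inr g ∈ B := by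
  by_contra hgB
  have h3 := hcore.2 _ ⟨hg, hgB⟩
  have hsub : {u | u ∈ H ∧ (CliqueGadget n ℓ G).Adj (Sum.inr g) u} ⊆
      {Sum.inl (greenFst g), Sum.inl (greenSnd g)} := by
    rintro (a | g') ⟨-, hu⟩
    · rcases CliqueGadget.adj_inl_inr hu.symm with rfl | rfl <;> simp
    · exact absurd hu (CliqueGadget.not_adj_inr_inr _ _)
  have h2 := (Set.ncard_le_ncard hsub).trans (Set.ncard_insert_le _ _)
  rw [Set.ncard_singleton] at h2
  omega

/-- A non-anchor `v^r_{ij}` has a green neighbor among the anchors. -/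
lemma IsAnchoredKCore.exists_green (hℓ : 3 ≤ ℓ)
    (hcore : IsAnchoredKCore (CliqueGadget n ℓ G) 3 B H)
    {a : CycleVert n ℓ} (ha : Sum.inl a ∈ H \ B) :
    ∃ g, Sum.inr g ∈ B ∧ (a = greenFst g ∨ a = greenSnd g) := by
  by_contra! hno
  have h3 := hcore.2 _ ha
  have hsub : {u | u ∈ H ∧ (CliqueGadget n ℓ G).Adj (Sum.inl a) u} ⊆
      {Sum.inl (a.next (by omega))} ∪
        Sum.inl '' (CycleVert.next (by omega) ⁻¹' {a}) := by
    rintro (b | g) ⟨hH, hu⟩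
    · rcases CliqueGadget.adj_inl_inl (by omega) hu with rfl | hb
      · simp
      · exact Or.inr ⟨b, hb, rfl⟩
    · have := hno g (hcore.inr_mem hH)
      have := CliqueGadget.adj_inl_inr hu
      tauto
  have h2 := (Set.ncard_le_ncard hsub).trans (Set.ncard_union_le _ _)
  have h1 : (CycleVert.next (by omega) ⁻¹' {a} : Set (CycleVert n ℓ)).ncard ≤ 1 :=
    Set.ncard_le_one_iff_subsingleton.2
      (Set.subsingleton_singleton.preimage (CycleVert.next_injective hℓ))
  rw [Set.ncard_singleton, Set.ncard_image_of_injective _ Sum.inl_injective] at h2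
  omega

/-- A non-anchor `v^r_{ij}` with at most one green neighbor among the anchors has
its successor on the cycle in the core. -/
lemma IsAnchoredKCore.next_mem (hℓ : 3 ≤ ℓ)
    (hcore : IsAnchoredKCore (CliqueGadget n ℓ G) 3 B H)
    {a : CycleVert n ℓ} (ha : Sum.inl a ∈ H \ B)
    (hone : {g | Sum.inr g ∈ B ∧ (a = greenFst g ∨ a = greenSnd g)}.Subsingleton) :
    Sum.inl (a.next (by omega)) ∈ H := by
  by_contra hno
  have h3 := hcore.2 _ ha
  have hsub : {u | u ∈ H ∧ (CliqueGadget n ℓ G).Adj (Sum.inl a) u} ⊆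
      Sum.inr '' {g | Sum.inr g ∈ B ∧ (a = greenFst g ∨ a = greenSnd g)} ∪
        Sum.inl '' (CycleVert.next (by omega) ⁻¹' {a}) := by
    rintro (b | g) ⟨hH, hu⟩
    · rcases CliqueGadget.adj_inl_inl (by omega) hu with rfl | hb
      · exact absurd hH hno
      · exact Or.inr ⟨b, hb, rfl⟩
    · exact Or.inl ⟨g, ⟨hcore.inr_mem hH, CliqueGadget.adj_inl_inr hu⟩, rfl⟩
  have h2 := (Set.ncard_le_ncard hsub).trans (Set.ncard_union_le _ _)
  have h1 : (CycleVert.next (by omega) ⁻¹' {a} : Set (CycleVert n ℓ)).ncard ≤ 1 :=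
    Set.ncard_le_one_iff_subsingleton.2
      (Set.subsingleton_singleton.preimage (CycleVert.next_injective hℓ))
  have h1' := Set.ncard_le_one_iff_subsingleton.2 hone
  rw [Set.ncard_image_of_injective _ Sum.inl_injective,
    Set.ncard_image_of_injective _ Sum.inr_injective] at h2
  omega

lemma ncard_cycles (c : Fin ℓ → Fin n) :
    {a : CycleVert n ℓ | a.1.1 = c a.1.2.1}.ncard = ℓ * (ℓ - 1) := by
  classical
  have himg : {a : CycleVert n ℓ | a.1.1 = c a.1.2.1} =
      Set.range fun p : {p : Fin ℓ × Fin ℓ // p.1 ≠ p.2} ↦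
        (⟨(c p.1.1, p.1.1, p.1.2), p.2⟩ : CycleVert n ℓ) := by
    ext ⟨⟨r, i, j⟩, hij⟩
    constructor
    · intro h
      obtain rfl : r = c i := h
      exact ⟨⟨(i, j), hij⟩, rfl⟩
    · rintro ⟨⟨⟨i', j'⟩, hij'⟩, h⟩
      simp only [Subtype.mk.injEq, Prod.mk.injEq] at h
      obtain ⟨rfl, rfl, rfl⟩ := h
      rfl
  have hinj : Function.Injective fun p : {p : Fin ℓ × Fin ℓ // p.1 ≠ p.2} ↦
      (⟨(c p.1.1, p.1.1, p.1.2), p.2⟩ : CycleVert n ℓ) := by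
    rintro ⟨⟨i, j⟩, hij⟩ ⟨⟨i', j'⟩, hij'⟩ h
    simp only [Subtype.mk.injEq, Prod.mk.injEq] at h
    simp [h.2.1, h.2.2]
  rw [himg, ← Set.image_univ, Set.ncard_image_of_injective _ hinj, Set.ncard_univ,
    Nat.card_eq_fintype_card, Fintype.card_subtype]
  have := Finset.offDiag_card (Finset.univ : Finset (Fin ℓ))
  rw [Finset.card_univ, Fintype.card_fin, ← Nat.mul_sub_one] at this
  rw [← this]
  congr 1
  ext p
  simp

end Gadget

theorem stmt_8 (n ℓ : ℕ) (hℓ : 4 ≤ ℓ) (G : SimpleGraph (Fin n))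
    (B H : Set (GadgetVert n ℓ G)) (hBH : B ⊆ H)
    (hB : B.ncard ≤ ℓ * (ℓ - 1) / 2) (hH : 3 * (ℓ * (ℓ - 1) / 2) ≤ H.ncard)
    (hcore : IsAnchoredKCore (CliqueGadget n ℓ G) 3 B H) :
    (∃ s : Finset (Fin n), G.IsNClique ℓ s) ∧
    (∀ x ∈ B, ∃ g, x = Sum.inr g) ∧
    B.ncard = ℓ * (ℓ - 1) / 2 ∧
    (H \ B).ncard = ℓ * (ℓ - 1) ∧
    ∃ c : Fin ℓ → Fin n,
      H \ B = {x : GadgetVert n ℓ G | ∃ (q j : Fin ℓ) (h : q ≠ j),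
        x = Sum.inl ⟨(c q, q, j), h⟩} ∧
      ∀ q r : Fin ℓ, q ≠ r → G.Adj (c q) (c r) := by
  have h3 : 3 ≤ ℓ := by omega
  have h2K : 2 * (ℓ * (ℓ - 1) / 2) = ℓ * (ℓ - 1) :=
    Nat.mul_div_cancel' (Nat.even_mul_pred_self ℓ).two_dvd
  have hpos : 0 < ℓ * (ℓ - 1) := Nat.mul_pos (by omega) (by omega)
  let T : Set (CycleVert n ℓ) := Sum.inl ⁻¹' (H \ B)
  let Q : Set (GreenVert n ℓ G) := Sum.inr ⁻¹' B
  have hT : H \ B = Sum.inl '' T := by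
    ext (a | g)
    · simp [T]
    · simpa [T] using fun hg ↦ hcore.inr_mem hg
  have hTcard : T.ncard = (H \ B).ncard := by
    rw [hT, Set.ncard_image_of_injective _ Sum.inl_injective]
  have hQB : Sum.inr '' Q ⊆ B := Set.image_preimage_subset _ _
  have hQcard : (Sum.inr '' Q : Set (GadgetVert n ℓ G)).ncard = Q.ncard :=
    Set.ncard_image_of_injective _ Sum.inr_injective
  have hQle := Set.ncard_le_ncard hQB
  have hdiff := Set.ncard_sdiff_add_ncard_of_subset hBH
  have hcover : T ⊆ greenFst '' Q ∪ greenSnd '' Q := by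
    intro a ha
    obtain ⟨g, hg, h | h⟩ := hcore.exists_green h3 ha
    · exact Or.inl ⟨g, hg, h.symm⟩
    · exact Or.inr ⟨g, hg, h.symm⟩
  have hle := Set.ncard_le_ncard hcover
  have hunion := Set.ncard_union_add_ncard_inter (greenFst '' Q) (greenSnd '' Q)
  have hfst := Set.ncard_image_le (f := greenFst) Q.toFinite
  have hsnd := Set.ncard_image_le (f := greenSnd) Q.toFinite
  have hTeq : T = greenFst '' Q ∪ greenSnd '' Q :=
    Set.eq_of_subset_of_ncard_le hcover (by omega)
  have hBeq : Sum.inr '' Q = B := Set.eq_of_subset_of_ncard_le hQB (by omega)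
  have hfstinj : Set.InjOn greenFst Q := (Set.ncard_image_iff).1 (by omega)
  have hsndinj : Set.InjOn greenSnd Q := (Set.ncard_image_iff).1 (by omega)
  have hdisj : greenFst '' Q ∩ greenSnd '' Q = ∅ := (Set.ncard_eq_zero).1 (by omega)
  have hone (a : CycleVert n ℓ) :
      {g | Sum.inr g ∈ B ∧ (a = greenFst g ∨ a = greenSnd g)}.Subsingleton := by
    rintro g ⟨hg, rfl | rfl⟩ g' ⟨hg', h | h⟩
    · exact hfstinj hg hg' h
    · exact absurd (hdisj.subset ⟨⟨g, hg, rfl⟩, ⟨g', hg', h.symm⟩⟩) (Set.notMem_empty _)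
    · exact absurd (hdisj.subset ⟨⟨g', hg', h.symm⟩, ⟨g, hg, rfl⟩⟩) (Set.notMem_empty _)
    · exact hsndinj hg hg' h
  have hnext (a : CycleVert n ℓ) (ha : a ∈ T) : a.next (by omega) ∈ T := by
    refine ⟨hcore.next_mem h3 ha (hone a), fun hmem ↦ ?_⟩
    rw [← hBeq] at hmem
    simp at hmem
  have hcycle {r : Fin n} {i j : Fin ℓ} (hij : i ≠ j)
      (h : (⟨(r, i, j), hij⟩ : CycleVert n ℓ) ∈ T) (k : Fin ℓ) (hk : i ≠ k) :
      (⟨(r, i, k), hk⟩ : CycleVert n ℓ) ∈ T := by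
    obtain ⟨_, hk'⟩ := cycNext_induction (by omega)
      (fun k ↦ ∃ hk : i ≠ k, (⟨(r, i, k), hk⟩ : CycleVert n ℓ) ∈ T)
      (fun j _ ⟨hj, hjT⟩ ↦ ⟨(cycNext_ne (by omega) i j).symm, hnext _ hjT⟩)
      hij.symm ⟨hij, h⟩ k hk.symm
    exact hk'
  have hpartner {r : Fin n} {i j : Fin ℓ} (hij : i ≠ j)
      (h : (⟨(r, i, j), hij⟩ : CycleVert n ℓ) ∈ T) :
      ∃ s, G.Adj r s ∧ (⟨(s, j, i), hij.symm⟩ : CycleVert n ℓ) ∈ T := by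
    obtain ⟨⟨⟨⟨r', s⟩, i', j'⟩, hadj, hlt⟩, hg, h | h⟩ := hcore.exists_green h3 h
    · simp only [greenFst, Subtype.mk.injEq, Prod.mk.injEq] at h
      obtain ⟨rfl, rfl, rfl⟩ := h
      exact ⟨s, hadj, hTeq ▸ Or.inr ⟨_, hg, rfl⟩⟩
    · simp only [greenSnd, Subtype.mk.injEq, Prod.mk.injEq] at h
      obtain ⟨rfl, rfl, rfl⟩ := h
      exact ⟨r', hadj.symm, hTeq ▸ Or.inl ⟨_, hg, rfl⟩⟩
  have hexists (q : Fin ℓ) :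
      ∃ r, ∀ (j : Fin ℓ) (h : q ≠ j), (⟨(r, q, j), h⟩ : CycleVert n ℓ) ∈ T := by
    obtain ⟨⟨⟨r, i, j⟩, hij⟩, ha⟩ : T.Nonempty :=
      Set.nonempty_of_ncard_ne_zero (by omega)
    by_cases hqi : i = q
    · subst hqi
      exact ⟨r, hcycle hij ha⟩
    · obtain ⟨s, -, hs⟩ := hpartner hqi (hcycle hij ha q hqi)
      exact ⟨s, hcycle _ hs⟩
  choose c hc using hexists
  have hTc : {a : CycleVert n ℓ | a.1.1 = c a.1.2.1} = T := by
    refine Set.eq_of_subset_of_ncard_le ?_ ?_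
    · rintro ⟨⟨r, i, j⟩, hij⟩ h
      obtain rfl : r = c i := h
      exact hc i j hij
    · rw [ncard_cycles]
      omega
  have hadj (q r : Fin ℓ) (hqr : q ≠ r) : G.Adj (c q) (c r) := by
    obtain ⟨s, hs, hsT⟩ := hpartner hqr (hc q r hqr)
    rw [← hTc] at hsT
    exact (show s = c r from hsT) ▸ hs
  have hcinj : Function.Injective c := fun q r h ↦ by
    by_contra hqr
    exact (hadj q r hqr).ne h
  refine ⟨⟨Finset.univ.map ⟨c, hcinj⟩, ?_, by simp⟩, ?_, by omega, by omega, c, ?_, hadj⟩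
  · intro x hx y hy hxy
    obtain ⟨q, rfl⟩ : ∃ q, c q = x := by simpa using hx
    obtain ⟨r, rfl⟩ : ∃ r, c r = y := by simpa using hy
    exact hadj q r fun h ↦ hxy (h ▸ rfl)
  · intro x hx
    rw [← hBeq] at hx
    obtain ⟨g, -, rfl⟩ := hx
    exact ⟨g, rfl⟩
  · rw [hT, ← hTc]
    ext x
    constructor
    · rintro ⟨⟨⟨r, i, j⟩, hij⟩, h, rfl⟩
      obtain rfl : r = c i := h
      exact ⟨i, j, hij, rfl⟩
    · rintro ⟨q, j, h, rfl⟩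
      exact ⟨_, rfl, rfl⟩
end
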